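/- arXiv:1003.4137 — 2 statements merged into one kernel-verified Lean document; each statement's English description precedes it below -/
import Mathlib

section
/- Let S⁰ be an adequate transversal of an abundant semigroup S. Then S⁰ is a quasi-ideal of S (i.e. S⁰SS⁰ ⊆ S⁰) if and only if RL ⊆ S⁰, where RL = {xy : x ∈ R, y ∈ L}. -/
/-!
Common framework: "relative" semigroup-theoretic notions.  All notions are taken
relative to a carrier set `U` inside an ambient type, together with an explicit
binary operation `mul` (only the values of `mul` on `U` are relevant).  For an
honest semigroup `S` one takes `U = Set.univ` and `mul = mulOf S`.

* `RStarOn mul U a b` : the relation `a ℛ* b` computed in `U` with an identity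
  adjoined (the two clauses correspond to multipliers from `U` and to the
  adjoined identity).
* `LStarOn`, `GreenLOn`, `GreenROn` : dual / Green's relations.
* `AbundantOn`, `AdequateOn`, `LeftAdequateOn`, `RightAdequateOn`.
* `AdequateTransversalOn mul U S0` : `S0` is an adequate `*`-subsemigroup of `U`
  which is an adequate transversal, with the data `bar x = x̄`, `e x = e_x`,
  `f x = f_x`, and `plus s = s⁺`, `star s = s⋆` for `s ∈ S0`.
* `InverseTransversalOn mul U S0` : `S0` is an inverse transversal of the
  regular semigroup `U`, with `o x = x⁰` the unique inverse of `x` in `S0`.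
-/

namespace Paper

universe u

variable {α : Type*} {β : Type*} {γ : Type*}

def mulOf (α : Type*) [Mul α] : α → α → α := fun a b => a * b

/-- `x` is an idempotent for the operation `mul`. -/
def Idem (mul : α → α → α) (x : α) : Prop := mul x x = x

/-- The relation `ℛ*` on `U` (with an identity adjoined to `U`). -/
def RStarOn (mul : α → α → α) (U : Set α) (a b : α) : Prop :=
  (∀ x ∈ U, ∀ y ∈ U, (mul x a = mul y a ↔ mul x b = mul y b)) ∧
  (∀ x ∈ U, (mul x a = a ↔ mul x b = b))

/-- The relation `ℒ*` on `U` (with an identity adjoined to `U`). -/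
def LStarOn (mul : α → α → α) (U : Set α) (a b : α) : Prop :=
  (∀ x ∈ U, ∀ y ∈ U, (mul a x = mul a y ↔ mul b x = mul b y)) ∧
  (∀ x ∈ U, (mul a x = a ↔ mul b x = b))

/-- Green's relation `ℒ` on `U`: `U¹ a = U¹ b`. -/
def GreenLOn (mul : α → α → α) (U : Set α) (a b : α) : Prop :=
  (a = b ∨ ∃ u ∈ U, mul u b = a) ∧ (b = a ∨ ∃ v ∈ U, mul v a = b)

/-- Green's relation `ℛ` on `U`: `a U¹ = b U¹`. -/
def GreenROn (mul : α → α → α) (U : Set α) (a b : α) : Prop :=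
  (a = b ∨ ∃ u ∈ U, mul b u = a) ∧ (b = a ∨ ∃ v ∈ U, mul a v = b)

/-- `U` is closed under `mul`. -/
def ClosedOn (mul : α → α → α) (U : Set α) : Prop :=
  ∀ a ∈ U, ∀ b ∈ U, mul a b ∈ U

/-- `U` with the operation `mul` is a semigroup. -/
def SemigroupOn (mul : α → α → α) (U : Set α) : Prop :=
  ClosedOn mul U ∧ ∀ a ∈ U, ∀ b ∈ U, ∀ c ∈ U, mul (mul a b) c = mul a (mul b c)

/-- Every `ℛ*`-class and every `ℒ*`-class of `U` contains an idempotent. -/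
def AbundantOn (mul : α → α → α) (U : Set α) : Prop :=
  ∀ a ∈ U, (∃ e ∈ U, Idem mul e ∧ RStarOn mul U a e) ∧
           (∃ f ∈ U, Idem mul f ∧ LStarOn mul U a f)

/-- Abundant with commuting idempotents. -/
def AdequateOn (mul : α → α → α) (U : Set α) : Prop :=
  AbundantOn mul U ∧
    ∀ u ∈ U, ∀ v ∈ U, Idem mul u → Idem mul v → mul u v = mul v u

/-- Abundant, and every `ℛ*`-class contains a unique idempotent. -/
def LeftAdequateOn (mul : α → α → α) (U : Set α) : Prop :=
  AbundantOn mul U ∧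
    ∀ u ∈ U, ∀ v ∈ U, Idem mul u → Idem mul v → RStarOn mul U u v → u = v

/-- Abundant, and every `ℒ*`-class contains a unique idempotent. -/
def RightAdequateOn (mul : α → α → α) (U : Set α) : Prop :=
  AbundantOn mul U ∧
    ∀ u ∈ U, ∀ v ∈ U, Idem mul u → Idem mul v → LStarOn mul U u v → u = v

/-- `S0` is a quasi-ideal of `U` : `S0 U S0 ⊆ S0`. -/
def QuasiIdealOn (mul : α → α → α) (U S0 : Set α) : Prop :=
  ∀ s ∈ S0, ∀ x ∈ U, ∀ t ∈ S0, mul (mul s x) t ∈ S0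

/-- Every element of `U` has an inverse in `U`. -/
def RegularOn (mul : α → α → α) (U : Set α) : Prop :=
  ∀ x ∈ U, ∃ u ∈ U, mul (mul x u) x = x ∧ mul (mul u x) u = u

/-- Regular with commuting idempotents, i.e. an inverse semigroup. -/
def InverseSgpOn (mul : α → α → α) (U : Set α) : Prop :=
  RegularOn mul U ∧
    ∀ u ∈ U, ∀ v ∈ U, Idem mul u → Idem mul v → mul u v = mul v u

/-- Regular, and every Green `ℛ`-class contains a unique idempotent. -/
def LeftInverseSgpOn (mul : α → α → α) (U : Set α) : Prop :=
  RegularOn mul U ∧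
    ∀ u ∈ U, ∀ v ∈ U, Idem mul u → Idem mul v → GreenROn mul U u v → u = v

/-- Regular, and every Green `ℒ`-class contains a unique idempotent. -/
def RightInverseSgpOn (mul : α → α → α) (U : Set α) : Prop :=
  RegularOn mul U ∧
    ∀ u ∈ U, ∀ v ∈ U, Idem mul u → Idem mul v → GreenLOn mul U u v → u = v

/-- An isomorphism from `(A, mulA)` onto `(B, mulB)`. -/
def IsoOn (mulA : α → α → α) (mulB : β → β → β) (A : Set α) (B : Set β) : Prop :=
  ∃ θ : α → β, Set.BijOn θ A B ∧ ∀ a ∈ A, ∀ b ∈ A, θ (mulA a b) = mulB (θ a) (θ b)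

/-- `S0` is an adequate transversal of the abundant semigroup `U`.  `S0` is an
adequate `*`-subsemigroup of `U` (witnessed by `plus`/`star`, the canonical
idempotents `a⁺ ℛ* a`, `a⋆ ℒ* a` of elements of `S0`, the `ℛ*`/`ℒ*` relations
being those of the big semigroup `U`, which gives the `*`-subsemigroup property),
and every `x ∈ U` factors uniquely as `x = e_x x̄ f_x` with `x̄ ∈ S0`,
`e_x, f_x` idempotents of `U`, `e_x ℒ x̄⁺` and `f_x ℛ x̄⋆`. -/
structure AdequateTransversalOn (mul : α → α → α) (U S0 : Set α) where
  sub : S0 ⊆ U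
  mul_mem : ∀ a ∈ S0, ∀ b ∈ S0, mul a b ∈ S0
  bar : α → α
  e : α → α
  f : α → α
  plus : α → α
  star : α → α
  plus_mem : ∀ a ∈ S0, plus a ∈ S0
  plus_idem : ∀ a ∈ S0, Idem mul (plus a)
  plus_rstar : ∀ a ∈ S0, RStarOn mul U a (plus a)
  star_mem : ∀ a ∈ S0, star a ∈ S0
  star_idem : ∀ a ∈ S0, Idem mul (star a)
  star_lstar : ∀ a ∈ S0, LStarOn mul U a (star a)
  idem_comm : ∀ u ∈ S0, ∀ v ∈ S0, Idem mul u → Idem mul v → mul u v = mul v u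
  bar_mem : ∀ x ∈ U, bar x ∈ S0
  e_mem : ∀ x ∈ U, e x ∈ U
  f_mem : ∀ x ∈ U, f x ∈ U
  e_idem : ∀ x ∈ U, Idem mul (e x)
  f_idem : ∀ x ∈ U, Idem mul (f x)
  decomp : ∀ x ∈ U, x = mul (mul (e x) (bar x)) (f x)
  e_greenL : ∀ x ∈ U, GreenLOn mul U (e x) (plus (bar x))
  f_greenR : ∀ x ∈ U, GreenROn mul U (f x) (star (bar x))
  unique : ∀ x ∈ U, ∀ s ∈ S0, ∀ e' ∈ U, ∀ f' ∈ U, Idem mul e' → Idem mul f' →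
      x = mul (mul e' s) f' → GreenLOn mul U e' (plus s) → GreenROn mul U f' (star s) →
      s = bar x ∧ e' = e x ∧ f' = f x

namespace AdequateTransversalOn

variable {mul : α → α → α} {U S0 : Set α}

/-- `R = {x ∈ U : e_x = e_{x̄}}`. -/
def Rset (T : AdequateTransversalOn mul U S0) : Set α :=
  {x | x ∈ U ∧ T.e x = T.e (T.bar x)}

/-- `L = {x ∈ U : f_x = f_{x̄}}`. -/
def Lset (T : AdequateTransversalOn mul U S0) : Set α :=
  {x | x ∈ U ∧ T.f x = T.f (T.bar x)}

/-- `I = {e_x : x ∈ U}`. -/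
def Iset (T : AdequateTransversalOn mul U S0) : Set α :=
  {y | ∃ x ∈ U, T.e x = y}

/-- `Λ = {f_x : x ∈ U}`. -/
def LamSet (T : AdequateTransversalOn mul U S0) : Set α :=
  {y | ∃ x ∈ U, T.f x = y}

/-- The transversal is multiplicative: `Λ I ⊆ E⁰`. -/
def IsMultiplicative (T : AdequateTransversalOn mul U S0) : Prop :=
  ∀ l ∈ T.LamSet, ∀ i ∈ T.Iset, mul l i ∈ S0 ∧ Idem mul (mul l i)

end AdequateTransversalOn

/-- The spined product set `T = L |×| R ⊆ S × S` attached to an adequate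
transversal of `S` (ambient carrier `U`). -/
def spSet {mul : α → α → α} {U S0 : Set α}
    (T : AdequateTransversalOn mul U S0) : Set (α × α) :=
  {p | p.1 ∈ T.Lset ∧ p.2 ∈ T.Rset ∧ T.bar p.1 = T.bar p.2}

/-- The multiplication `(x,a)(y,b) = (e_x(ay), (ay) f_b)` on the spined product. -/
def spMul {mul : α → α → α} {U S0 : Set α}
    (T : AdequateTransversalOn mul U S0) : α × α → α × α → α × α :=
  fun p q => (mul (T.e p.1) (mul p.2 q.1), mul (mul p.2 q.1) (T.f q.2))

/-- The map `φ : S → T`, `x ↦ (e_x x̄, x̄ f_x)`. -/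
def phiMap {mul : α → α → α} {U S0 : Set α}
    (T : AdequateTransversalOn mul U S0) : α → α × α :=
  fun x => (mul (T.e x) (T.bar x), mul (T.bar x) (T.f x))

/-- `T⁰ = {(s,s) : s ∈ S0}`. -/
def diagSet (S0 : Set α) : Set (α × α) := {p | ∃ s ∈ S0, p = (s, s)}

/-- Abstract spined product `L |×| R` over a common transversal `S⁰` (a type `γ`
embedded into `L` and `R` by `jL`, `jR`). -/
def absTset {mulL : α → α → α} {mulR : β → β → β} {jL : γ → α} {jR : γ → β}
    (TL : AdequateTransversalOn mulL Set.univ (Set.range jL))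
    (TR : AdequateTransversalOn mulR Set.univ (Set.range jR)) : Set (α × β) :=
  {p | ∃ s : γ, jL s = TL.bar p.1 ∧ jR s = TR.bar p.2}

/-- The multiplication `(x,a)(y,b) = (e_x(a∗y), (a∗y) f_b)`. -/
def absMul {mulL : α → α → α} {mulR : β → β → β} {jL : γ → α} {jR : γ → β}
    (TL : AdequateTransversalOn mulL Set.univ (Set.range jL))
    (TR : AdequateTransversalOn mulR Set.univ (Set.range jR))
    (st : β → α → γ) : α × β → α × β → α × β :=
  fun p q => (mulL (TL.e p.1) (jL (st p.2 q.1)), mulR (jR (st p.2 q.1)) (TR.f q.2))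

/-- `T⁰ = {(s,s) : s ∈ S⁰}` inside `L × R`, where `s` is viewed in `L` and in `R`. -/
def absT0 (jL : γ → α) (jR : γ → β) : Set (α × β) :=
  {p | ∃ s : γ, p = (jL s, jR s)}

/-- `S0` is an inverse transversal of the regular semigroup `U`: an inverse
subsemigroup meeting the set of inverses of each `x ∈ U` in exactly one
element `o x = x⁰`. -/
structure InverseTransversalOn (mul : α → α → α) (U S0 : Set α) where
  sub : S0 ⊆ U
  mul_mem : ∀ a ∈ S0, ∀ b ∈ S0, mul a b ∈ S0
  o : α → α
  o_mem : ∀ x ∈ U, o x ∈ S0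
  o_inv1 : ∀ x ∈ U, mul (mul x (o x)) x = x
  o_inv2 : ∀ x ∈ U, mul (mul (o x) x) (o x) = o x
  o_unique : ∀ x ∈ U, ∀ u ∈ S0, mul (mul x u) x = x → mul (mul u x) u = u → u = o x
  idem_comm : ∀ u ∈ S0, ∀ v ∈ S0, Idem mul u → Idem mul v → mul u v = mul v u

namespace InverseTransversalOn

variable {mul : α → α → α} {U S0 : Set α}

/-- `L = {x ∈ U : x⁰x ∈ E⁰}`. -/
def LsetI (T : InverseTransversalOn mul U S0) : Set α :=
  {x | x ∈ U ∧ mul (T.o x) x ∈ S0 ∧ Idem mul (mul (T.o x) x)}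

/-- `R = {x ∈ U : xx⁰ ∈ E⁰}`. -/
def RsetI (T : InverseTransversalOn mul U S0) : Set α :=
  {x | x ∈ U ∧ mul x (T.o x) ∈ S0 ∧ Idem mul (mul x (T.o x))}

end InverseTransversalOn

/-- Spined product set for an inverse transversal: `{(x,a) : x⁰ = a⁰}`. -/
def invSpSet {mul : α → α → α} {U S0 : Set α}
    (T : InverseTransversalOn mul U S0) : Set (α × α) :=
  {p | p.1 ∈ T.LsetI ∧ p.2 ∈ T.RsetI ∧ T.o p.1 = T.o p.2}

/-- The multiplication `(x,a)(y,b) = ((xx⁰)(ay), (ay)(b⁰b))`. -/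
def invSpMul {mul : α → α → α} {U S0 : Set α}
    (T : InverseTransversalOn mul U S0) : α × α → α × α → α × α :=
  fun p q => (mul (mul p.1 (T.o p.1)) (mul p.2 q.1),
              mul (mul p.2 q.1) (mul (T.o q.2) q.2))

/-- Abstract spined product for inverse transversals: `{(x,a) : x⁰ = a⁰}`. -/
def invAbsTset {mulL : α → α → α} {mulR : β → β → β} {jL : γ → α} {jR : γ → β}
    (TL : InverseTransversalOn mulL Set.univ (Set.range jL))
    (TR : InverseTransversalOn mulR Set.univ (Set.range jR)) : Set (α × β) :=
  {p | ∃ s : γ, jL s = TL.o p.1 ∧ jR s = TR.o p.2}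

/-- The multiplication `(x,a)(y,b) = ((xx⁰)(a∗y), (a∗y)(b⁰b))`. -/
def invAbsMul {mulL : α → α → α} {mulR : β → β → β} {jL : γ → α} {jR : γ → β}
    (TL : InverseTransversalOn mulL Set.univ (Set.range jL))
    (TR : InverseTransversalOn mulR Set.univ (Set.range jR))
    (st : β → α → γ) : α × β → α × β → α × β :=
  fun p q => (mulL (mulL p.1 (TL.o p.1)) (jL (st p.2 q.1)),
              mulR (jR (st p.2 q.1)) (mulR (TR.o q.2) q.2))

/-- The multiplication `(e,x)(g,w) = (e(aa⁻¹), a)`, `a = x((x⁻¹x)g)w`, on `I × S⁰`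
(Chen-style construction from a left normal band `I` with semilattice transversal
`E⁰ = E(S⁰)`; `σ` embeds idempotents of the inverse semigroup `γ` into the band
`β`, and `π : β → γ` is the semilattice-transversal map `e ↦ e⁰`). -/
def bandMul (mulB : β → β → β) (mulG : γ → γ → γ) (σ : γ → β) (π : β → γ)
    (inv : γ → γ) (p q : β × γ) : β × γ :=
  let a := mulG (mulG p.2 (π (mulB (σ (mulG (inv p.2) p.2)) q.1))) q.2
  (mulB p.1 (σ (mulG a (inv a))), a)

/-- `T = {(e,x) : e⁰ = xx⁻¹}`. -/
def bandTset (mulG : γ → γ → γ) (π : β → γ) (inv : γ → γ) : Set (β × γ) :=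
  {p | π p.1 = mulG p.2 (inv p.2)}

/-- `T⁰ = {(aa⁻¹, a) : a ∈ S⁰}` (with `aa⁻¹` viewed in the band via `σ`). -/
def bandT0 (mulG : γ → γ → γ) (σ : γ → β) (inv : γ → γ) : Set (β × γ) :=
  {p | ∃ s : γ, p = (σ (mulG s (inv s)), s)}

end Paper

namespace Paper.AdequateTransversalOn

variable {S : Type*} [Semigroup S] {S0 : Set S}

theorem plus_eq_self (T : AdequateTransversalOn (mulOf S) Set.univ S0) {u : S}
    (hu : u ∈ S0) (hi : Idem (mulOf S) u) : T.plus u = u := by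
  have h := (T.plus_rstar u hu).2
  have h1 := (h u trivial).1 hi
  have h2 := (h (T.plus u) trivial).2 (T.plus_idem u hu)
  rw [← h1, T.idem_comm u hu _ (T.plus_mem u hu) hi (T.plus_idem u hu), h2]

theorem star_eq_self (T : AdequateTransversalOn (mulOf S) Set.univ S0) {u : S}
    (hu : u ∈ S0) (hi : Idem (mulOf S) u) : T.star u = u := by
  have h := (T.star_lstar u hu).2
  have h1 := (h u trivial).1 hi
  have h2 := (h (T.star u) trivial).2 (T.star_idem u hu)
  rw [← h1, ← T.idem_comm u hu _ (T.star_mem u hu) hi (T.star_idem u hu), h2]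

theorem plus_mul_self (T : AdequateTransversalOn (mulOf S) Set.univ S0) {s : S}
    (hs : s ∈ S0) : T.plus s * s = s :=
  ((T.plus_rstar s hs).2 _ trivial).2 (T.plus_idem s hs)

theorem self_mul_star (T : AdequateTransversalOn (mulOf S) Set.univ S0) {s : S}
    (hs : s ∈ S0) : s * T.star s = s :=
  ((T.star_lstar s hs).2 _ trivial).2 (T.star_idem s hs)

theorem data_of_mem (T : AdequateTransversalOn (mulOf S) Set.univ S0) {s : S} (hs : s ∈ S0) :
    s = T.bar s ∧ T.plus s = T.e s ∧ T.star s = T.f s := by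
  refine T.unique s trivial s hs _ trivial _ trivial (T.plus_idem s hs) (T.star_idem s hs) ?_
    ⟨Or.inl rfl, Or.inl rfl⟩ ⟨Or.inl rfl, Or.inl rfl⟩
  change s = T.plus s * s * T.star s
  rw [T.plus_mul_self hs, T.self_mul_star hs]

theorem mem_Rset_of_mem (T : AdequateTransversalOn (mulOf S) Set.univ S0) {s : S}
    (hs : s ∈ S0) : s ∈ T.Rset :=
  ⟨trivial, by rw [← (T.data_of_mem hs).1]⟩

theorem mem_Lset_of_mem (T : AdequateTransversalOn (mulOf S) Set.univ S0) {s : S}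
    (hs : s ∈ S0) : s ∈ T.Lset :=
  ⟨trivial, by rw [← (T.data_of_mem hs).1]⟩

theorem e_mul_of_greenL {e p : S} (hp : Idem (mulOf S) p)
    (h : GreenLOn (mulOf S) Set.univ e p) : e * p = e := by
  replace hp : p * p = p := hp
  rcases h.1 with h | ⟨u, -, h⟩
  · rw [h, hp]
  · replace h : u * p = e := h
    rw [← h, mul_assoc, hp]

theorem mul_f_of_greenR {f q : S} (hq : Idem (mulOf S) q)
    (h : GreenROn (mulOf S) Set.univ f q) : q * f = f := by
  replace hq : q * q = q := hq
  rcases h.1 with h | ⟨u, -, h⟩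
  · rw [h, hq]
  · replace h : q * u = f := h
    rw [← h, ← mul_assoc, hq]

theorem e_mem_Lset (T : AdequateTransversalOn (mulOf S) Set.univ S0) (x : S) :
    T.e x ∈ T.Lset := by
  have hb := T.bar_mem x trivial
  have hp := T.plus_mem _ hb
  have hi := T.plus_idem _ hb
  have hL := T.e_greenL x trivial
  have he := e_mul_of_greenL hi hL
  have h := T.unique (T.e x) trivial _ hp (T.e x) trivial _ trivial (T.e_idem x trivial) hi
    (by change T.e x = T.e x * _ * _; rw [he, he])
    (by rwa [T.plus_eq_self hp hi])
    (by rw [T.star_eq_self hp hi]; exact ⟨Or.inl rfl, Or.inl rfl⟩)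
  refine ⟨trivial, ?_⟩
  rw [← h.1, ← h.2.2, ← (T.data_of_mem hp).2.2, T.star_eq_self hp hi]

theorem f_mem_Rset (T : AdequateTransversalOn (mulOf S) Set.univ S0) (x : S) :
    T.f x ∈ T.Rset := by
  have hb := T.bar_mem x trivial
  have hq := T.star_mem _ hb
  have hi := T.star_idem _ hb
  have hR := T.f_greenR x trivial
  have hf := mul_f_of_greenR hi hR
  have h := T.unique (T.f x) trivial _ hq _ trivial (T.f x) trivial hi (T.f_idem x trivial)
    (by change T.f x = _ * _ * T.f x; rw [mul_assoc, hf, hf])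
    (by rw [T.plus_eq_self hq hi]; exact ⟨Or.inl rfl, Or.inl rfl⟩)
    (by rwa [T.star_eq_self hq hi])
  refine ⟨trivial, ?_⟩
  rw [← h.1, ← h.2.1, ← (T.data_of_mem hq).2.1, T.plus_eq_self hq hi]

theorem eq_bar_mul_f_of_mem_Rset (T : AdequateTransversalOn (mulOf S) Set.univ S0) {x : S}
    (hx : x ∈ T.Rset) : x = T.bar x * T.f x := by
  have hb := T.bar_mem x trivial
  have h : x = T.e x * T.bar x * T.f x := T.decomp x trivial
  rwa [hx.2, ← (T.data_of_mem hb).2.1, T.plus_mul_self hb] at h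

theorem eq_e_mul_bar_of_mem_Lset (T : AdequateTransversalOn (mulOf S) Set.univ S0) {x : S}
    (hx : x ∈ T.Lset) : x = T.e x * T.bar x := by
  have hb := T.bar_mem x trivial
  have h : x = T.e x * T.bar x * T.f x := T.decomp x trivial
  rwa [hx.2, ← (T.data_of_mem hb).2.2, mul_assoc, T.self_mul_star hb] at h

end Paper.AdequateTransversalOn

open Paper in
/-- Let `S⁰` be an adequate transversal of an abundant semigroup
`S`. Then `S⁰` is a quasi-ideal of `S` iff `RL ⊆ S⁰`. -/
theorem stmt0 {S : Type*} [Semigroup S] (S0 : Set S)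
    (hS : AbundantOn (mulOf S) Set.univ)
    (T : AdequateTransversalOn (mulOf S) Set.univ S0) :
    QuasiIdealOn (mulOf S) Set.univ S0 ↔
      ∀ x ∈ T.Rset, ∀ y ∈ T.Lset, x * y ∈ S0 := by
  constructor
  · intro hQ x hx y hy
    have h : T.bar x * (T.f x * T.e y) * T.bar y ∈ S0 :=
      hQ _ (T.bar_mem x trivial) _ trivial _ (T.bar_mem y trivial)
    rw [T.eq_bar_mul_f_of_mem_Rset hx, T.eq_e_mul_bar_of_mem_Lset hy]
    simpa only [mul_assoc] using h
  · intro hRL s hs x _ t ht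
    have h1 := hRL s (T.mem_Rset_of_mem hs) _ (T.e_mem_Lset x)
    have h2 := hRL _ (T.f_mem_Rset x) t (T.mem_Lset_of_mem ht)
    have h : s * T.e x * T.bar x * (T.f x * t) ∈ S0 :=
      T.mul_mem _ (T.mul_mem _ h1 _ (T.bar_mem x trivial)) _ h2
    have hd : x = T.e x * T.bar x * T.f x := T.decomp x trivial
    have he : s * x * t = s * T.e x * T.bar x * (T.f x * t) := by
      conv_lhs => rw [hd]
      simp only [mul_assoc]
    change s * x * t ∈ S0
    rwa [he]
end

section
/- Let S⁰ be a quasi-ideal adequate transversal of an abundant semigroup S. Then for every a ∈ R and y ∈ L the product ay lies in S⁰; moreover for (x,a), (y,b) ∈ T = {(x,a) ∈ L × R : x̄ = ā} one has e_x a y ∈ L, a y f_b ∈ R, and \overline{e_x a y} = ay = \overline{a y f_b}, so that (x,a)(y,b) = (e_x a y, a y f_b) defines a binary operation on T. -/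
namespace Paper

section

variable {S : Type*} [Semigroup S] {S0 : Set S}

theorem GreenLOn.mul_eq {e p : S} (h : GreenLOn (mulOf S) Set.univ e p)
    (he : e * e = e) (hp : p * p = p) : e * p = e ∧ p * e = p := by
  obtain ⟨rfl | ⟨u, -, hu⟩, h2⟩ := h
  · exact ⟨he, he⟩
  · replace hu : u * p = e := hu
    refine ⟨by rw [← hu, mul_assoc, hp], ?_⟩
    rcases h2 with rfl | ⟨v, -, hv⟩
    · exact hp
    · replace hv : v * e = p := hv
      rw [← hv, mul_assoc, he]

theorem GreenROn.mul_eq {f q : S} (h : GreenROn (mulOf S) Set.univ f q)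
    (hf : f * f = f) (hq : q * q = q) : q * f = f ∧ f * q = q := by
  obtain ⟨rfl | ⟨u, -, hu⟩, h2⟩ := h
  · exact ⟨hf, hf⟩
  · replace hu : q * u = f := hu
    refine ⟨by rw [← hu, ← mul_assoc, hq], ?_⟩
    rcases h2 with rfl | ⟨v, -, hv⟩
    · exact hq
    · replace hv : f * v = q := hv
      rw [← hv, ← mul_assoc, hf]

namespace AdequateTransversalOn

variable (T : AdequateTransversalOn (mulOf S) Set.univ S0)

theorem plus_mul_plus {s : S} (hs : s ∈ S0) : T.plus s * T.plus s = T.plus s :=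
  T.plus_idem s hs

theorem star_mul_star {s : S} (hs : s ∈ S0) : T.star s * T.star s = T.star s :=
  T.star_idem s hs

theorem plus_mul {s : S} (hs : s ∈ S0) : T.plus s * s = s :=
  ((T.plus_rstar s hs).2 (T.plus s) trivial).2 (T.plus_idem s hs)

theorem mul_star {s : S} (hs : s ∈ S0) : s * T.star s = s :=
  ((T.star_lstar s hs).2 (T.star s) trivial).2 (T.star_idem s hs)

theorem mul_plus_eq {s u : S} (hs : s ∈ S0) (h : u * s = s) :
    u * T.plus s = T.plus s :=
  ((T.plus_rstar s hs).2 u trivial).1 h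

theorem star_mul_eq {s u : S} (hs : s ∈ S0) (h : s * u = s) :
    T.star s * u = T.star s :=
  ((T.star_lstar s hs).2 u trivial).1 h

theorem e_mul_plus_bar (x : S) :
    T.e x * T.plus (T.bar x) = T.e x ∧ T.plus (T.bar x) * T.e x = T.plus (T.bar x) :=
  (T.e_greenL x trivial).mul_eq (T.e_idem x trivial) (T.plus_idem _ (T.bar_mem x trivial))

theorem star_bar_mul_f (x : S) :
    T.star (T.bar x) * T.f x = T.f x ∧ T.f x * T.star (T.bar x) = T.star (T.bar x) :=
  (T.f_greenR x trivial).mul_eq (T.f_idem x trivial) (T.star_idem _ (T.bar_mem x trivial))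

theorem decomp_of_mem {s : S} (hs : s ∈ S0) :
    s = T.bar s ∧ T.plus s = T.e s ∧ T.star s = T.f s := by
  refine T.unique s trivial s hs _ trivial _ trivial (T.plus_idem s hs) (T.star_idem s hs) ?_
    ⟨Or.inl rfl, Or.inl rfl⟩ ⟨Or.inl rfl, Or.inl rfl⟩
  change s = T.plus s * s * T.star s
  rw [T.plus_mul hs, T.mul_star hs]

theorem eq_bar_mul_f {a : S} (ha : a ∈ T.Rset) : a = T.bar a * T.f a := by
  have hb := T.bar_mem a trivial
  have h : a = T.e a * T.bar a * T.f a := T.decomp a trivial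
  rwa [ha.2, ← (T.decomp_of_mem hb).2.1, T.plus_mul hb] at h

theorem eq_e_mul_bar {y : S} (hy : y ∈ T.Lset) : y = T.e y * T.bar y := by
  have hb := T.bar_mem y trivial
  have h : y = T.e y * T.bar y * T.f y := T.decomp y trivial
  rwa [hy.2, ← (T.decomp_of_mem hb).2.2, mul_assoc, T.mul_star hb] at h

theorem plus_bar_mul {a : S} (ha : a ∈ T.Rset) : T.plus (T.bar a) * a = a := by
  have h := congrArg (· * T.f a) (T.plus_mul (T.bar_mem a trivial))
  simpa only [mul_assoc, ← T.eq_bar_mul_f ha] using h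

theorem mul_star_bar {y : S} (hy : y ∈ T.Lset) : y * T.star (T.bar y) = y := by
  have h := congrArg (T.e y * ·) (T.mul_star (T.bar_mem y trivial))
  simpa only [← mul_assoc, ← T.eq_e_mul_bar hy] using h

theorem mul_mem_of_quasiIdeal (hq : QuasiIdealOn (mulOf S) Set.univ S0) {a y : S}
    (ha : a ∈ T.Rset) (hy : y ∈ T.Lset) : a * y ∈ S0 := by
  have h : T.bar a * (T.f a * T.e y) * T.bar y ∈ S0 :=
    hq _ (T.bar_mem a trivial) _ trivial _ (T.bar_mem y trivial)
  rwa [← mul_assoc, ← T.eq_bar_mul_f ha, mul_assoc, ← T.eq_e_mul_bar hy] at h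

/-- Multiplying `s ∈ S⁰` on the left by `e_x` does not change the transversal component
as soon as `x̄⁺` fixes `s`. -/
theorem e_mul_decomp {s x : S} (hs : s ∈ S0) (h : T.plus (T.bar x) * s = s) :
    T.bar (T.e x * s) = s ∧ T.e x * s ∈ T.Lset := by
  have hb := T.bar_mem x trivial
  have hps : T.plus s * T.plus (T.bar x) = T.plus s :=
    (T.idem_comm _ (T.plus_mem s hs) _ (T.plus_mem _ hb)
      (T.plus_idem s hs) (T.plus_idem _ hb)).trans (T.mul_plus_eq hs h)
  have hpe : T.plus s * T.e x = T.plus s := by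
    rw [← hps, mul_assoc, (T.e_mul_plus_bar x).2]
  have key := T.unique (T.e x * s) trivial s hs (T.e x * T.plus s) trivial (T.star s) trivial
    (show T.e x * T.plus s * (T.e x * T.plus s) = T.e x * T.plus s by
      rw [mul_assoc, ← mul_assoc (T.plus s), hpe, T.plus_mul_plus hs])
    (T.star_idem s hs)
    (show T.e x * s = T.e x * T.plus s * s * T.star s by
      rw [mul_assoc, mul_assoc, T.mul_star hs, T.plus_mul hs])
    ⟨Or.inr ⟨T.e x, trivial, rfl⟩, Or.inr ⟨T.plus s, trivial,
      show T.plus s * (T.e x * T.plus s) = T.plus s by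
        rw [← mul_assoc, hpe, T.plus_mul_plus hs]⟩⟩
    ⟨Or.inl rfl, Or.inl rfl⟩
  refine ⟨key.1.symm, trivial, ?_⟩
  rw [← key.1, ← key.2.2, (T.decomp_of_mem hs).2.2]

/-- Multiplying `s ∈ S⁰` on the right by `f_b` does not change the transversal component
as soon as `b̄⋆` fixes `s`. -/
theorem mul_f_decomp {s b : S} (hs : s ∈ S0) (h : s * T.star (T.bar b) = s) :
    T.bar (s * T.f b) = s ∧ s * T.f b ∈ T.Rset := by
  have hb := T.bar_mem b trivial
  have hps : T.star (T.bar b) * T.star s = T.star s :=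
    (T.idem_comm _ (T.star_mem _ hb) _ (T.star_mem s hs)
      (T.star_idem _ hb) (T.star_idem s hs)).trans (T.star_mul_eq hs h)
  have hpf : T.f b * T.star s = T.star s := by
    rw [← hps, ← mul_assoc, (T.star_bar_mul_f b).2]
  have key := T.unique (s * T.f b) trivial s hs (T.plus s) trivial (T.star s * T.f b) trivial
    (T.plus_idem s hs)
    (show T.star s * T.f b * (T.star s * T.f b) = T.star s * T.f b by
      rw [mul_assoc, ← mul_assoc (T.f b), hpf, ← mul_assoc, T.star_mul_star hs])
    (show s * T.f b = T.plus s * s * (T.star s * T.f b) by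
      rw [T.plus_mul hs, ← mul_assoc, T.mul_star hs])
    ⟨Or.inl rfl, Or.inl rfl⟩
    ⟨Or.inr ⟨T.f b, trivial, rfl⟩, Or.inr ⟨T.star s, trivial,
      show T.star s * T.f b * T.star s = T.star s by
        rw [mul_assoc, hpf, T.star_mul_star hs]⟩⟩
  refine ⟨key.1.symm, trivial, ?_⟩
  rw [← key.1, ← key.2.1, (T.decomp_of_mem hs).2.1]

end AdequateTransversalOn

end

end Paper

open Paper in
/-- Let `S⁰` be a quasi-ideal adequate transversal of an abundant
semigroup `S`.  For `a ∈ R`, `y ∈ L` one has `ay ∈ S⁰`; and for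
`(x,a), (y,b) ∈ T = {(x,a) ∈ L × R : x̄ = ā}` one has `e_x a y ∈ L`,
`a y f_b ∈ R`, `\overline{e_x a y} = ay = \overline{a y f_b}`, so that
`(x,a)(y,b) = (e_x a y, a y f_b)` defines a binary operation on `T`. -/
theorem stmt4 {S : Type*} [Semigroup S] (S0 : Set S)
    (hS : AbundantOn (mulOf S) Set.univ)
    (T : AdequateTransversalOn (mulOf S) Set.univ S0)
    (hq : QuasiIdealOn (mulOf S) Set.univ S0) :
    (∀ a ∈ T.Rset, ∀ y ∈ T.Lset, a * y ∈ S0) ∧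
    (∀ x a y b : S, x ∈ T.Lset → a ∈ T.Rset → T.bar x = T.bar a →
      y ∈ T.Lset → b ∈ T.Rset → T.bar y = T.bar b →
      T.e x * (a * y) ∈ T.Lset ∧ (a * y) * T.f b ∈ T.Rset ∧
      T.bar (T.e x * (a * y)) = a * y ∧ T.bar ((a * y) * T.f b) = a * y ∧
      (T.e x * (a * y), (a * y) * T.f b) ∈ spSet T) := by
  refine ⟨fun a ha y hy => T.mul_mem_of_quasiIdeal hq ha hy, fun x a y b _ ha hxa hy _ hyb => ?_⟩
  have hs := T.mul_mem_of_quasiIdeal hq ha hy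
  obtain ⟨hbl, hl⟩ := T.e_mul_decomp (x := x) hs
    (by rw [hxa, ← mul_assoc, T.plus_bar_mul ha])
  obtain ⟨hbr, hr⟩ := T.mul_f_decomp (b := b) hs
    (by rw [← hyb, mul_assoc, T.mul_star_bar hy])
  exact ⟨hl, hr, hbl, hbr, hl, hr, hbl.trans hbr.symm⟩
end
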